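/- Let σ_e, σ_β > 0, θ ∈ (0,1), and let μ be the Bernoulli-Laplace prior with density (with respect to δ₀ for the atom and Lebesgue measure for the slab) (1 − θ)δ₀ + θ (1/(√2 σ_β)) exp(−√2 |β| / σ_β). With F_{σ_β}(y) = exp(√2 y / σ_β) Φ(−y/σ_e − √2 σ_e/σ_β) and marginal density m(y) = (1 − θ) φ_{σ_e}(y) + θ (1/(√2 σ_β)) e^{σ_e²/σ_β²} (F_{σ_β}(y) + F_{σ_β}(−y)), the posterior mean satisfies, for every y ∈ ℝ: E[β | y] = (y − [(F_{σ_β}(−y) − F_{σ_β}(y))/(F_{σ_β}(−y) + F_{σ_β}(y))] · √2 σ_e²/σ_β) · (1 + (1 − θ) φ_{σ_e}(y) / (θ (1/(√2 σ_β)) e^{σ_e²/σ_β²} (F_{σ_β}(y) + F_{σ_β}(−y))))^{−1}. -/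

import Mathlib

open MeasureTheory

/-- The density of the normal distribution `N(0, σ²)` at `t`. -/
noncomputable def gaussPdf (σ t : ℝ) : ℝ :=
  (Real.sqrt (2 * Real.pi * σ ^ 2))⁻¹ * Real.exp (-(t ^ 2) / (2 * σ ^ 2))

/-- The standard normal cumulative distribution function. -/
noncomputable def stdNormalCdf (x : ℝ) : ℝ :=
  ∫ t in Set.Iic x, gaussPdf 1 t

open Set in
theorem setIntegral_Ioi_comp_sub_right (f : ℝ → ℝ) (a c : ℝ) :
    ∫ x in Ioi a, f (x - c) = ∫ x in Ioi (a - c), f x := by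
  rw [← integral_indicator measurableSet_Ioi, ← integral_indicator measurableSet_Ioi,
    ← integral_sub_right_eq_self ((Ioi (a - c)).indicator f) c]
  congr 1
  ext x
  simp [indicator]

theorem gaussPdf_pos {σ : ℝ} (hσ : 0 < σ) (t : ℝ) : 0 < gaussPdf σ t := by
  unfold gaussPdf
  have := Real.pi_pos
  positivity

theorem gaussPdf_neg (σ t : ℝ) : gaussPdf σ (-t) = gaussPdf σ t := by
  simp [gaussPdf]

theorem gaussPdf_eq_inv_mul_one {σ : ℝ} (hσ : 0 < σ) (t : ℝ) :
    gaussPdf σ t = σ⁻¹ * gaussPdf 1 (σ⁻¹ * t) := by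
  unfold gaussPdf
  have h : Real.sqrt (2 * Real.pi * σ ^ 2) = Real.sqrt (2 * Real.pi * 1 ^ 2) * σ := by
    rw [Real.sqrt_mul' _ (by positivity), Real.sqrt_sq hσ.le]
    simp
  rw [h, mul_inv]
  have h2 : -(t ^ 2) / (2 * σ ^ 2) = -((σ⁻¹ * t) ^ 2) / (2 * 1 ^ 2) := by
    field_simp
  rw [h2]
  ring

theorem hasDerivAt_gaussPdf {σ : ℝ} (hσ : 0 < σ) (t : ℝ) :
    HasDerivAt (gaussPdf σ) (-(t / σ ^ 2) * gaussPdf σ t) t := by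
  have h1 : HasDerivAt (fun t : ℝ => -(t ^ 2) / (2 * σ ^ 2)) (-(t / σ ^ 2)) t := by
    convert! ((hasDerivAt_pow 2 t).neg.div_const (2 * σ ^ 2)) using 1
    simp
    field_simp
  convert! (h1.exp.const_mul (Real.sqrt (2 * Real.pi * σ ^ 2))⁻¹) using 1
  unfold gaussPdf
  ring

theorem integrable_gaussPdf {σ : ℝ} (hσ : 0 < σ) : Integrable (gaussPdf σ) := by
  have h := (integrable_exp_neg_mul_sq (b := 1 / (2 * σ ^ 2)) (by positivity)).const_mul
    (Real.sqrt (2 * Real.pi * σ ^ 2))⁻¹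
  refine h.congr (.of_forall fun t => ?_)
  simp only [gaussPdf]
  congr 2
  ring

theorem integrable_mul_gaussPdf {σ : ℝ} (hσ : 0 < σ) :
    Integrable fun t => t * gaussPdf σ t := by
  have h := (integrable_mul_exp_neg_mul_sq (b := 1 / (2 * σ ^ 2)) (by positivity)).const_mul
    (Real.sqrt (2 * Real.pi * σ ^ 2))⁻¹
  refine h.congr (.of_forall fun t => ?_)
  simp only [gaussPdf]
  rw [show -(t ^ 2) / (2 * σ ^ 2) = -(1 / (2 * σ ^ 2)) * t ^ 2 by ring]
  ring

theorem integrable_gaussPdf_sub {σ : ℝ} (hσ : 0 < σ) (c : ℝ) :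
    Integrable fun t => gaussPdf σ (t - c) :=
  (integrable_gaussPdf hσ).comp_sub_right c

theorem integrable_mul_gaussPdf_sub {σ : ℝ} (hσ : 0 < σ) (c : ℝ) :
    Integrable fun t => t * gaussPdf σ (t - c) := by
  refine (((integrable_mul_gaussPdf hσ).comp_sub_right c).add
    ((integrable_gaussPdf_sub hσ c).const_mul c)).congr (.of_forall fun t => ?_)
  simp only [Pi.add_apply]
  ring

theorem stdNormalCdf_pos (x : ℝ) : 0 < stdNormalCdf x := by
  have h := integrable_gaussPdf one_pos
  rw [stdNormalCdf, setIntegral_pos_iff_support_of_nonneg_ae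
    (.of_forall fun t => (gaussPdf_pos one_pos t).le) h.integrableOn]
  have : Function.support (gaussPdf 1) = Set.univ :=
    Set.eq_univ_of_forall fun t => (gaussPdf_pos one_pos t).ne'
  simp [this]

theorem setIntegral_gaussPdf_sub {σ : ℝ} (hσ : 0 < σ) (c : ℝ) :
    ∫ t in Set.Ioi 0, gaussPdf σ (t - c) = stdNormalCdf (c / σ) := by
  rw [setIntegral_Ioi_comp_sub_right (gaussPdf σ)]
  simp_rw [gaussPdf_eq_inv_mul_one hσ]
  rw [integral_const_mul, integral_comp_mul_left_Ioi (gaussPdf 1) _ (inv_pos.2 hσ), stdNormalCdf]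
  have h := integral_comp_neg_Iic (c / σ) (gaussPdf 1)
  simp_rw [gaussPdf_neg] at h
  rw [h, smul_eq_mul, inv_inv, inv_mul_cancel_left₀ hσ.ne']
  congr 3
  field_simp
  simp

/-- The first moment of a normal distribution restricted to the positive half-line. -/
theorem setIntegral_mul_gaussPdf_sub {σ : ℝ} (hσ : 0 < σ) (c : ℝ) :
    ∫ t in Set.Ioi 0, t * gaussPdf σ (t - c)
      = c * stdNormalCdf (c / σ) + σ ^ 2 * gaussPdf σ c := by
  have hd : ∀ t : ℝ, HasDerivAt (fun t => -σ ^ 2 * gaussPdf σ (t - c))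
      (t * gaussPdf σ (t - c) - c * gaussPdf σ (t - c)) t := fun t => by
    convert! (((hasDerivAt_gaussPdf hσ (t - c)).comp_sub_const t c).const_mul (-σ ^ 2)) using 1
    field_simp
  have hi := (integrable_mul_gaussPdf_sub hσ c).sub ((integrable_gaussPdf_sub hσ c).const_mul c)
  have h := integral_Ioi_of_hasDerivAt_of_tendsto' (a := 0) (fun t _ => hd t) hi.integrableOn
    (tendsto_zero_of_hasDerivAt_of_integrableOn_Ioi (a := 0) (fun t _ => hd t) hi.integrableOn
      ((integrable_gaussPdf_sub hσ c).const_mul _).integrableOn)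
  rw [integral_sub (integrable_mul_gaussPdf_sub hσ c).integrableOn
    ((integrable_gaussPdf_sub hσ c).const_mul c).integrableOn, integral_const_mul,
    setIntegral_gaussPdf_sub hσ, zero_sub c, gaussPdf_neg] at h
  linarith

theorem gaussPdf_sub_mul_exp {σ : ℝ} (hσ : 0 < σ) (b y t : ℝ) :
    gaussPdf σ (y - t) * Real.exp (-(b * t))
      = Real.exp (b ^ 2 * σ ^ 2 / 2 - b * y) * gaussPdf σ (t - (y - b * σ ^ 2)) := by
  unfold gaussPdf
  rw [mul_assoc, ← Real.exp_add, mul_left_comm, ← Real.exp_add]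
  congr 2
  field_simp
  ring

theorem setIntegral_mul_gaussPdf_mul_exp {σ : ℝ} (hσ : 0 < σ) (b y : ℝ) :
    ∫ t in Set.Ioi 0, t * gaussPdf σ (y - t) * Real.exp (-(b * t))
      = Real.exp (b ^ 2 * σ ^ 2 / 2) * ((y - b * σ ^ 2) *
          (Real.exp (-(b * y)) * stdNormalCdf (y / σ - b * σ))) + σ ^ 2 * gaussPdf σ y := by
  have h0 := gaussPdf_sub_mul_exp hσ b y 0
  simp only [mul_zero, neg_zero, Real.exp_zero, mul_one, sub_zero, zero_sub (y - _),
    gaussPdf_neg] at h0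
  simp_rw [mul_assoc, gaussPdf_sub_mul_exp hσ,
    mul_left_comm _ (Real.exp (b ^ 2 * σ ^ 2 / 2 - b * y))]
  rw [integral_const_mul, setIntegral_mul_gaussPdf_sub hσ, h0,
    show (y - b * σ ^ 2) / σ = y / σ - b * σ by field_simp, sub_eq_add_neg, Real.exp_add]
  ring

theorem integrable_mul_gaussPdf_mul_exp_abs {σ b : ℝ} (hσ : 0 < σ) (hb : 0 ≤ b) (y : ℝ) :
    Integrable fun t => t * gaussPdf σ (y - t) * Real.exp (-(b * |t|)) := by
  have h := integrable_mul_gaussPdf_sub hσ y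
  simp_rw [← gaussPdf_neg σ (_ - y), neg_sub] at h
  refine h.mul_bdd (c := 1) (by fun_prop) (.of_forall fun t => ?_)
  rw [Real.norm_eq_abs, Real.abs_exp, Real.exp_le_one_iff]
  have := abs_nonneg t
  simp only [Left.neg_nonpos_iff]
  positivity

/-- The unnormalized posterior first moment under a Laplace prior. -/
theorem integral_mul_gaussPdf_mul_exp_abs {σ b : ℝ} (hσ : 0 < σ) (hb : 0 ≤ b) (y : ℝ) :
    ∫ t, t * gaussPdf σ (y - t) * Real.exp (-(b * |t|))
      = Real.exp (b ^ 2 * σ ^ 2 / 2) *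
        ((y - b * σ ^ 2) * (Real.exp (-(b * y)) * stdNormalCdf (y / σ - b * σ))
          + (y + b * σ ^ 2) * (Real.exp (b * y) * stdNormalCdf (-(y / σ) - b * σ))) := by
  have hi := integrable_mul_gaussPdf_mul_exp_abs hσ hb y
  have hpos : ∫ t in Set.Ioi 0, t * gaussPdf σ (y - t) * Real.exp (-(b * |t|))
      = ∫ t in Set.Ioi 0, t * gaussPdf σ (y - t) * Real.exp (-(b * t)) :=
    setIntegral_congr_fun measurableSet_Ioi fun t ht => by
      simp only [abs_of_pos (Set.mem_Ioi.1 ht)]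
  have hneg : ∫ t in Set.Iic 0, t * gaussPdf σ (y - t) * Real.exp (-(b * |t|))
      = -∫ t in Set.Ioi 0, t * gaussPdf σ (-y - t) * Real.exp (-(b * t)) := by
    rw [← integral_neg]
    have h := integral_comp_neg_Iic 0 fun t => -(t * gaussPdf σ (-y - t) * Real.exp (-(b * t)))
    rw [neg_zero] at h
    rw [← h]
    refine setIntegral_congr_fun measurableSet_Iic fun t ht => ?_
    simp only [abs_of_nonpos (Set.mem_Iic.1 ht)]
    rw [show -y - -t = -(y - t) by ring, gaussPdf_neg]
    ring
  rw [← intervalIntegral.integral_Iic_add_Ioi hi.integrableOn hi.integrableOn, hpos, hneg,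
    setIntegral_mul_gaussPdf_mul_exp hσ, setIntegral_mul_gaussPdf_mul_exp hσ, gaussPdf_neg,
    neg_div, mul_neg, neg_neg]
  ring

/-- Posterior mean under the Bernoulli-Laplace prior
`μ = (1 − θ)δ₀ + θ Laplace(σ_β)`: with
`F_{σ_β}(y) = exp(√2 y/σ_β) Φ(−y/σ_e − √2 σ_e/σ_β)` and marginal density
`m(y) = (1 − θ)φ_{σ_e}(y) + θ (1/(√2 σ_β)) e^{σ_e²/σ_β²}(F(y) + F(−y))`,
`E[β | y] = (y − [(F(−y) − F(y))/(F(−y) + F(y))]·√2 σ_e²/σ_β)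
  · (1 + (1 − θ)φ_{σ_e}(y)/(θ (1/(√2 σ_β)) e^{σ_e²/σ_β²}(F(y) + F(−y))))⁻¹`. -/
theorem bernoulli_laplace_posterior_mean (σe σβ θ : ℝ)
    (hσe : 0 < σe) (hσβ : 0 < σβ) (hθ : θ ∈ Set.Ioo (0 : ℝ) 1)
    (μ : Measure ℝ)
    (hμ : μ = ENNReal.ofReal (1 - θ) • Measure.dirac (0 : ℝ)
        + ENNReal.ofReal θ •
            volume.withDensity (fun β => ENNReal.ofReal
              ((Real.sqrt 2 * σβ)⁻¹ * Real.exp (-(Real.sqrt 2 * |β|) / σβ))))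
    (F : ℝ → ℝ)
    (hF : ∀ y, F y = Real.exp (Real.sqrt 2 * y / σβ)
        * stdNormalCdf (-(y / σe) - Real.sqrt 2 * σe / σβ))
    (m : ℝ → ℝ)
    (hm : ∀ y, m y = (1 - θ) * gaussPdf σe y
        + θ * ((Real.sqrt 2 * σβ)⁻¹ * Real.exp (σe ^ 2 / σβ ^ 2) * (F y + F (-y)))) :
    ∀ y : ℝ,
      (∫ β : ℝ, β * gaussPdf σe (y - β) ∂μ) / m y
        = (y - (F (-y) - F y) / (F (-y) + F y) * (Real.sqrt 2 * σe ^ 2 / σβ))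
            * (1 + (1 - θ) * gaussPdf σe y
                / (θ * ((Real.sqrt 2 * σβ)⁻¹ * Real.exp (σe ^ 2 / σβ ^ 2)
                    * (F y + F (-y)))))⁻¹ := by
  intro y
  obtain ⟨hθ0, hθ1⟩ := hθ
  have hs2 : Real.sqrt 2 ^ 2 = 2 := Real.sq_sqrt zero_le_two
  have hs2pos : 0 < Real.sqrt 2 := by positivity
  set b : ℝ := Real.sqrt 2 / σβ with hb
  have hbpos : 0 < b := by positivity
  have hFy : F y = Real.exp (b * y) * stdNormalCdf (-(y / σe) - b * σe) := by
    rw [hF, hb, div_mul_eq_mul_div, div_mul_eq_mul_div]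
  have hFny : F (-y) = Real.exp (-(b * y)) * stdNormalCdf (y / σe - b * σe) := by
    rw [hF, hb, div_mul_eq_mul_div, div_mul_eq_mul_div, mul_neg, neg_div, neg_div, neg_neg]
  have hexp : Real.exp (b ^ 2 * σe ^ 2 / 2) = Real.exp (σe ^ 2 / σβ ^ 2) := by
    congr 1
    rw [hb, div_pow, hs2]
    ring
  have hbσ : Real.sqrt 2 * σe ^ 2 / σβ = b * σe ^ 2 := by rw [hb]; ring
  have hslab := integral_mul_gaussPdf_mul_exp_abs hσe hbpos.le y
  rw [← hFy, ← hFny, hexp] at hslab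
  have hdens : ∀ t : ℝ, (ENNReal.ofReal
      ((Real.sqrt 2 * σβ)⁻¹ * Real.exp (-(Real.sqrt 2 * |t|) / σβ))).toReal
        • (t * gaussPdf σe (y - t))
      = (Real.sqrt 2 * σβ)⁻¹ * (t * gaussPdf σe (y - t) * Real.exp (-(b * |t|))) := fun t => by
    rw [ENNReal.toReal_ofReal (by positivity), hb, smul_eq_mul, neg_div, div_mul_eq_mul_div]
    ring
  have hmeas : Measurable fun t : ℝ => ENNReal.ofReal
      ((Real.sqrt 2 * σβ)⁻¹ * Real.exp (-(Real.sqrt 2 * |t|) / σβ)) := by fun_prop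
  have hint : ∫ t, t * gaussPdf σe (y - t) ∂μ = θ * ((Real.sqrt 2 * σβ)⁻¹ *
      (Real.exp (σe ^ 2 / σβ ^ 2) * ((y - b * σe ^ 2) * F (-y) + (y + b * σe ^ 2) * F y))) := by
    rw [hμ, integral_add_measure, integral_smul_measure, integral_smul_measure, integral_dirac,
      integral_withDensity_eq_integral_toReal_smul hmeas
        (.of_forall fun _ => ENNReal.ofReal_lt_top)]
    · simp_rw [hdens]
      rw [integral_const_mul, hslab, ENNReal.toReal_ofReal hθ0.le]
      simp
    · exact (integrable_dirac (by simp)).smul_measure ENNReal.ofReal_ne_top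
    · refine Integrable.smul_measure ?_ ENNReal.ofReal_ne_top
      rw [integrable_withDensity_iff_integrable_smul' hmeas
        (.of_forall fun _ => ENNReal.ofReal_lt_top)]
      simp_rw [hdens]
      exact (integrable_mul_gaussPdf_mul_exp_abs hσe hbpos.le y).const_mul _
  have hF1 : 0 < F y := hFy ▸ mul_pos (Real.exp_pos _) (stdNormalCdf_pos _)
  have hF2 : 0 < F (-y) := hFny ▸ mul_pos (Real.exp_pos _) (stdNormalCdf_pos _)
  have hg := mul_pos (sub_pos.2 hθ1) (gaussPdf_pos hσe y)
  rw [hint, hm, hbσ]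
  generalize (1 - θ) * gaussPdf σe y = K at *
  have hS : 0 < F y + F (-y) := add_pos hF1 hF2
  have hS' : 0 < F (-y) + F y := add_pos hF2 hF1
  have hL : 0 < θ * ((Real.sqrt 2 * σβ)⁻¹ * Real.exp (σe ^ 2 / σβ ^ 2) * (F y + F (-y))) := by
    positivity
  rw [one_add_div hL.ne', inv_div, add_comm K, ← mul_div_assoc]
  congr 1
  field_simp
  ring
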